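/- With the setup below, define m_1,…,m_N ∈ 𝕂ˣ by: for 1 ≤ k ≤ n−1 and 1 ≤ a ≤ n−k, m_{s_k+a} := z_{1+s_{n−a}} if k = 1, and m_{s_k+a} := z_{k+s_{n−k−a+1}} / z_{k−1+s_{n−k−a+1}} if k ≥ 2. Let t_R be the diagonal matrix whose entries are the diagonal entries of b. Then b = y_{i_1}(m_1⁻¹)·y_{i_2}(m_2⁻¹)⋯y_{i_N}(m_N⁻¹)·t_R, where (i_1,…,i_N) = 𝐢₀. -/

import Mathlib

open Matrix

/-- `yMat n 𝕂 i z` is the n×n identity matrix except entry (i+1, i) (1-based) equals `z`. -/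
def yMat (n : ℕ) (𝕂 : Type*) [Field 𝕂] (i : ℕ) (z : 𝕂) :
    Matrix (Fin n) (Fin n) 𝕂 :=
  fun a b => if a = b then 1 else if (a : ℕ) = i ∧ (b : ℕ) + 1 = i then z else 0

/-- `xMat n 𝕂 i z` is the n×n identity matrix except entry (i, i+1) (1-based) equals `z`. -/
def xMat (n : ℕ) (𝕂 : Type*) [Field 𝕂] (i : ℕ) (z : 𝕂) :
    Matrix (Fin n) (Fin n) 𝕂 :=
  fun a b => if a = b then 1 else if (a : ℕ) + 1 = i ∧ (b : ℕ) = i then z else 0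

/-- `xNegMat n 𝕂 i z` is the identity except the 2×2 block in rows/cols i, i+1 (1-based)
equals [[z⁻¹, 0], [1, z]]. -/
noncomputable def xNegMat (n : ℕ) (𝕂 : Type*) [Field 𝕂] (i : ℕ) (z : 𝕂) :
    Matrix (Fin n) (Fin n) 𝕂 :=
  fun a b =>
    if (a : ℕ) + 1 = i ∧ (b : ℕ) + 1 = i then z⁻¹
    else if (a : ℕ) = i ∧ (b : ℕ) = i then z
    else if (a : ℕ) = i ∧ (b : ℕ) + 1 = i then 1
    else if a = b then 1 else 0

/-- The matrix w̄₀ with (i, n+1−i) entry (−1)^(n−i) (1-based) and other entries 0. -/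
def w0bar (n : ℕ) (𝕂 : Type*) [Field 𝕂] : Matrix (Fin n) (Fin n) 𝕂 :=
  fun a b => if (a : ℕ) + (b : ℕ) = n - 1 then (-1 : 𝕂) ^ (n - 1 - (a : ℕ)) else 0

/-- s_k = Σ_{j=1}^{k−1} (n−j). -/
def sIdx (n k : ℕ) : ℕ := ∑ j ∈ Finset.Icc 1 (k - 1), (n - j)

/-- The word 𝐢₀ = (1,2,…,n−1, 1,2,…,n−2, …, 1,2, 1). -/
def wordI0 (n : ℕ) : List ℕ :=
  (List.range (n - 1)).flatMap (fun k => (List.range (n - 1 - k)).map (· + 1))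

/-- The word 𝐢′₀ = (n−1,…,1, n−1,…,2, …, n−1,n−2, n−1). -/
def wordI0' (n : ℕ) : List ℕ :=
  (List.range (n - 1)).flatMap (fun k => (List.range (n - 1 - k)).map (fun a => n - 1 - a))

/-- The simple reflection s_i = (i, i+1) (1-based) as a permutation of `Fin n`. -/
def sPerm (n i : ℕ) : Equiv.Perm (Fin n) :=
  if h : 1 ≤ i ∧ i < n then Equiv.swap ⟨i - 1, by omega⟩ ⟨i, h.2⟩ else 1

/-- The longest element of S_n, k ↦ n+1−k (1-based). -/
def w0Perm (n : ℕ) : Equiv.Perm (Fin n) where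
  toFun a := ⟨n - 1 - (a : ℕ), by have := a.isLt; omega⟩
  invFun a := ⟨n - 1 - (a : ℕ), by have := a.isLt; omega⟩
  left_inv a := by
    have := a.isLt
    apply Fin.ext
    show n - 1 - (n - 1 - (a : ℕ)) = (a : ℕ)
    omega
  right_inv a := by
    have := a.isLt
    apply Fin.ext
    show n - 1 - (n - 1 - (a : ℕ)) = (a : ℕ)
    omega

/-- Apply a permutation of `Fin n` to a 1-based label in {1, …, n}. -/
def permApp {n : ℕ} (σ : Equiv.Perm (Fin n)) (x : ℕ) : ℕ :=
  if h : 1 ≤ x ∧ x ≤ n then ((σ ⟨x - 1, by omega⟩ : Fin n) : ℕ) + 1 else x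


section Combinatorics

theorem sIdx_succ_succ (n k : ℕ) : sIdx n (k + 2) = sIdx n (k + 1) + (n - 1 - k) := by
  have h : n - 1 - k = n - (k + 1) := by omega
  simp [sIdx, Finset.sum_Icc_succ_top, h]

theorem sIdx_one (n : ℕ) : sIdx n 1 = 0 := by simp [sIdx]

theorem two_mul_sIdx (n k : ℕ) (hk : k + 1 ≤ n) :
    2 * sIdx n (k + 1) + k * (k + 1) = 2 * n * k := by
  induction k with
  | zero => simp [sIdx_one]
  | succ k ih =>
    obtain ⟨r, rfl⟩ : ∃ r, n = k + 2 + r := ⟨n - (k + 2), by omega⟩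
    rw [sIdx_succ_succ]
    have h : k + 2 + r - 1 - k = r + 1 := by omega
    rw [h]
    have := ih (by omega)
    nlinarith

theorem sIdx_self (n : ℕ) (hn : 1 ≤ n) : sIdx n n = n * (n - 1) / 2 := by
  obtain ⟨k, rfl⟩ : ∃ k, n = k + 1 := ⟨n - 1, by omega⟩
  have := two_mul_sIdx (k + 1) k le_rfl
  have h : (k + 1) * (k + 1 - 1) = 2 * sIdx (k + 1) (k + 1) := by
    simp only [Nat.add_sub_cancel]
    nlinarith
  omega

theorem sIdx_succ_mono (n : ℕ) : Monotone fun k => sIdx n (k + 1) :=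
  monotone_nat_of_le_succ fun k => by
    rw [sIdx_succ_succ]
    omega

theorem sIdx_add_le (n j k : ℕ) (hn : 2 ≤ n) (hk : 1 ≤ k) (hjk : j + k ≤ n - 1) :
    sIdx n (j + 1) + k ≤ n * (n - 1) / 2 := by
  have h : sIdx n (j + 1 + 1) ≤ sIdx n (n - 1 + 1) := sIdx_succ_mono n (by omega : j + 1 ≤ n - 1)
  rw [sIdx_succ_succ, Nat.sub_add_cancel (by omega), sIdx_self n (by omega)] at h
  omega

theorem length_wordI0_prefix (n k : ℕ) :
    ((List.range k).flatMap (fun k => (List.range (n - 1 - k)).map (· + 1))).length =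
      sIdx n (k + 1) := by
  induction k with
  | zero => simp [sIdx_one]
  | succ k ih => simp [List.range_succ, List.flatMap_append, ih, sIdx_succ_succ]

theorem wordI0_getD (n k a : ℕ) (ha : a < n - 1 - k) :
    (wordI0 n).getD (sIdx n (k + 1) + a) 0 = a + 1 := by
  have h : List.range (n - 1) = List.range (k + (1 + (n - 1 - k - 1))) := by
    congr 1
    omega
  rw [wordI0, h, List.range_add, List.flatMap_append, List.getD_append_right _ _ _ _
    (by rw [length_wordI0_prefix]; omega), length_wordI0_prefix, List.range_add, List.map_append,
    List.flatMap_append, List.getD_append _ _ _ _ (by simp; omega)]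
  simp [List.getD_eq_getElem?_getD, ha]

theorem prod_wordI0 {M : Type*} [Monoid M] (n : ℕ) (f : ℕ → ℕ → M) (k : ℕ) (hk : k ≤ n - 1) :
    ((List.range (sIdx n (k + 1))).map fun t => f ((wordI0 n).getD t 0) (t + 1)).prod =
      ((List.range k).map fun i => ((List.range (n - 1 - i)).map
        fun a => f (a + 1) (sIdx n (i + 1) + (a + 1))).prod).prod := by
  induction k with
  | zero => simp [sIdx_one]
  | succ k ih =>
    rw [sIdx_succ_succ, List.range_add, List.map_append, List.prod_append, ih (by omega),
      List.range_succ, List.map_append, List.prod_append]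
    congr 1
    simp only [List.map_map, List.map_cons, List.map_nil, List.prod_cons, List.prod_nil, mul_one]
    congr 1
    refine List.map_congr_left fun a ha => ?_
    simp only [Function.comp_apply]
    rw [wordI0_getD n k a (by simpa using ha), add_assoc]

end Combinatorics

section Matrices

variable {n : ℕ} {𝕂 : Type*} [Field 𝕂]

/-- The standard basis vector with 0-based label `k`, which is zero when `n ≤ k`. -/
def natBasis (n : ℕ) (𝕂 : Type*) [Field 𝕂] (k : ℕ) : Fin n → 𝕂 :=
  fun a => if (a : ℕ) = k then 1 else 0

theorem mulVec_natBasis (M : Matrix (Fin n) (Fin n) 𝕂) (k : Fin n) :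
    M *ᵥ natBasis n 𝕂 k = fun a => M a k := by
  funext a
  simp [Matrix.mulVec, dotProduct, natBasis, Fin.val_inj]

theorem ext_natBasis {M M' : Matrix (Fin n) (Fin n) 𝕂}
    (h : ∀ k < n, M *ᵥ natBasis n 𝕂 k = M' *ᵥ natBasis n 𝕂 k) : M = M' := by
  ext a k
  have := congrFun (h k k.2) a
  simpa [mulVec_natBasis] using this

theorem yMat_mulVec_self (i : ℕ) (hi : i + 1 < n) (t : 𝕂) :
    yMat n 𝕂 (i + 1) t *ᵥ natBasis n 𝕂 i = natBasis n 𝕂 i + t • natBasis n 𝕂 (i + 1) := by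
  have := mulVec_natBasis (yMat n 𝕂 (i + 1) t) ⟨i, by omega⟩
  simp only at this
  rw [this]
  funext a
  simp only [yMat, natBasis, Pi.add_apply, Pi.smul_apply, smul_eq_mul, Fin.ext_iff, and_true]
  split_ifs <;> first | omega | simp

theorem yMat_mulVec_of_ne (i k : ℕ) (hk : k < n) (hki : k ≠ i) (t : 𝕂) :
    yMat n 𝕂 (i + 1) t *ᵥ natBasis n 𝕂 k = natBasis n 𝕂 k := by
  have := mulVec_natBasis (yMat n 𝕂 (i + 1) t) ⟨k, hk⟩
  simp only at this
  rw [this]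
  funext a
  simp only [yMat, natBasis, Fin.ext_iff]
  split_ifs <;> first | omega | simp

theorem xNegMat_mulVec_self (i : ℕ) (hi : i + 1 < n) (t : 𝕂) :
    xNegMat n 𝕂 (i + 1) t *ᵥ natBasis n 𝕂 i =
      t⁻¹ • natBasis n 𝕂 i + natBasis n 𝕂 (i + 1) := by
  have := mulVec_natBasis (xNegMat n 𝕂 (i + 1) t) ⟨i, by omega⟩
  simp only at this
  rw [this]
  funext a
  simp only [xNegMat, natBasis, Pi.add_apply, Pi.smul_apply, smul_eq_mul, Fin.ext_iff, and_true]
  split_ifs <;> first | omega | simp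

theorem xNegMat_mulVec_succ (i : ℕ) (hi : i + 1 < n) (t : 𝕂) :
    xNegMat n 𝕂 (i + 1) t *ᵥ natBasis n 𝕂 (i + 1) = t • natBasis n 𝕂 (i + 1) := by
  have := mulVec_natBasis (xNegMat n 𝕂 (i + 1) t) ⟨i + 1, hi⟩
  simp only at this
  rw [this]
  funext a
  simp only [xNegMat, natBasis, Pi.smul_apply, smul_eq_mul, Fin.ext_iff, and_true]
  split_ifs <;> first | omega | simp

theorem xNegMat_mulVec_of_ne (i k : ℕ) (hk : k < n) (hki : k ≠ i) (hki' : k ≠ i + 1) (t : 𝕂) :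
    xNegMat n 𝕂 (i + 1) t *ᵥ natBasis n 𝕂 k = natBasis n 𝕂 k := by
  have := mulVec_natBasis (xNegMat n 𝕂 (i + 1) t) ⟨k, hk⟩
  simp only at this
  rw [this]
  funext a
  simp only [xNegMat, natBasis, Fin.ext_iff]
  split_ifs <;> first | omega | simp

/-- The product `y₁(t 0) ⋯ y_r(t (r - 1))`. -/
def yRow (n : ℕ) {𝕂 : Type*} [Field 𝕂] (t : ℕ → 𝕂) (r : ℕ) : Matrix (Fin n) (Fin n) 𝕂 :=
  ((List.range r).map fun a => yMat n 𝕂 (a + 1) (t a)).prod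

theorem yRow_succ (t : ℕ → 𝕂) (r : ℕ) :
    yRow n t (r + 1) = yRow n t r * yMat n 𝕂 (r + 1) (t r) := by
  simp [yRow, List.range_succ]

theorem yRow_mulVec_of_le (t : ℕ → 𝕂) (r k : ℕ) (hk : k < n) (hrk : r ≤ k) :
    yRow n t r *ᵥ natBasis n 𝕂 k = natBasis n 𝕂 k := by
  induction r with
  | zero => simp [yRow]
  | succ r ih =>
    rw [yRow_succ, ← mulVec_mulVec, yMat_mulVec_of_ne r k hk (by omega), ih (by omega)]

theorem yRow_mulVec_of_lt (t : ℕ → 𝕂) (r k : ℕ) (hr : r < n) (hkr : k < r) :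
    yRow n t r *ᵥ natBasis n 𝕂 k = natBasis n 𝕂 k + t k • natBasis n 𝕂 (k + 1) := by
  induction r with
  | zero => omega
  | succ r ih =>
    rw [yRow_succ, ← mulVec_mulVec]
    rcases Nat.lt_succ_iff_lt_or_eq.mp hkr with h | rfl
    · rw [yMat_mulVec_of_ne r k (by omega) (by omega), ih (by omega) h]
    · rw [yMat_mulVec_self k hr, mulVec_add, mulVec_smul,
        yRow_mulVec_of_le t k k (by omega) le_rfl, yRow_mulVec_of_le t k _ hr (by omega)]

/-- The product `x₋₁(w 1) ⋯ x₋ᵣ(w r)`. -/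
noncomputable def xNegRow (n : ℕ) {𝕂 : Type*} [Field 𝕂] (w : ℕ → 𝕂) (r : ℕ) :
    Matrix (Fin n) (Fin n) 𝕂 :=
  ((List.range r).map fun a => xNegMat n 𝕂 (a + 1) (w (a + 1))).prod

theorem xNegRow_succ (w : ℕ → 𝕂) (r : ℕ) :
    xNegRow n w (r + 1) = xNegRow n w r * xNegMat n 𝕂 (r + 1) (w (r + 1)) := by
  simp [xNegRow, List.range_succ]

theorem xNegRow_mulVec_of_gt (w : ℕ → 𝕂) (r k : ℕ) (hk : k < n) (hrk : r < k) :
    xNegRow n w r *ᵥ natBasis n 𝕂 k = natBasis n 𝕂 k := by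
  induction r with
  | zero => simp [xNegRow]
  | succ r ih =>
    rw [xNegRow_succ, ← mulVec_mulVec, xNegMat_mulVec_of_ne r k hk (by omega) (by omega),
      ih (by omega)]

theorem xNegRow_mulVec_self (w : ℕ → 𝕂) (hw : w 0 = 1) (r : ℕ) (hr : r < n) :
    xNegRow n w r *ᵥ natBasis n 𝕂 r = w r • natBasis n 𝕂 r := by
  cases r with
  | zero => simp [xNegRow, hw]
  | succ r =>
    rw [xNegRow_succ, ← mulVec_mulVec, xNegMat_mulVec_succ r hr, mulVec_smul,
      xNegRow_mulVec_of_gt w r _ hr (by omega)]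

theorem xNegRow_mulVec_of_lt (w : ℕ → 𝕂) (hw : w 0 = 1) (r k : ℕ) (hr : r < n) (hkr : k < r) :
    xNegRow n w r *ᵥ natBasis n 𝕂 k =
      (w k / w (k + 1)) • natBasis n 𝕂 k + natBasis n 𝕂 (k + 1) := by
  induction r with
  | zero => omega
  | succ r ih =>
    rw [xNegRow_succ, ← mulVec_mulVec]
    rcases Nat.lt_succ_iff_lt_or_eq.mp hkr with h | rfl
    · rw [xNegMat_mulVec_of_ne r k (by omega) (by omega) (by omega), ih (by omega) h]
    · rw [xNegMat_mulVec_self k hr, mulVec_add, mulVec_smul,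
        xNegRow_mulVec_self w hw k (by omega), xNegRow_mulVec_of_gt w k _ hr (by omega),
        smul_smul, div_eq_inv_mul]

theorem w0bar_mulVec (k : ℕ) (hk : k < n) :
    w0bar n 𝕂 *ᵥ natBasis n 𝕂 k = (-1 : 𝕂) ^ k • natBasis n 𝕂 (n - 1 - k) := by
  have := mulVec_natBasis (w0bar n 𝕂) ⟨k, hk⟩
  simp only at this
  rw [this]
  funext a
  simp only [w0bar, natBasis, Pi.smul_apply, smul_eq_mul]
  by_cases h : (a : ℕ) + k = n - 1
  · rw [if_pos h, if_pos (by omega), mul_one]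
    congr 1
    omega
  · rw [if_neg h, if_neg (by omega), mul_zero]

theorem w0bar_transpose_mulVec (k : ℕ) (hk : k < n) :
    (w0bar n 𝕂)ᵀ *ᵥ natBasis n 𝕂 k = (-1 : 𝕂) ^ (n - 1 - k) • natBasis n 𝕂 (n - 1 - k) := by
  have := mulVec_natBasis (w0bar n 𝕂)ᵀ ⟨k, hk⟩
  simp only at this
  rw [this]
  funext a
  simp only [w0bar, natBasis, Pi.smul_apply, smul_eq_mul, transpose_apply]
  by_cases h : k + (a : ℕ) = n - 1
  · rw [if_pos h, if_pos (by omega), mul_one]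
  · rw [if_neg h, if_neg (by omega), mul_zero]

theorem w0bar_transpose_mul_self : (w0bar n 𝕂)ᵀ * w0bar n 𝕂 = 1 := by
  refine ext_natBasis fun k hk => ?_
  rw [← mulVec_mulVec, w0bar_mulVec k hk, mulVec_smul, w0bar_transpose_mulVec _ (by omega),
    smul_smul, one_mulVec, (by omega : n - 1 - (n - 1 - k) = k), ← pow_add,
    Even.neg_one_pow ⟨k, rfl⟩, one_smul]

theorem w0bar_mul_transpose : w0bar n 𝕂 * (w0bar n 𝕂)ᵀ = 1 :=
  mul_eq_one_comm.mp w0bar_transpose_mul_self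

theorem w0bar_eq_smul_transpose : w0bar n 𝕂 = (-1 : 𝕂) ^ (n - 1) • (w0bar n 𝕂)ᵀ := by
  refine ext_natBasis fun k hk => ?_
  rw [smul_mulVec, w0bar_mulVec k hk, w0bar_transpose_mulVec k hk, smul_smul, ← pow_add]
  congr 1
  rw [(by omega : n - 1 + (n - 1 - k) = k + 2 * (n - 1 - k)), pow_add, pow_mul]
  simp

theorem w0bar_mul_apply (M : Matrix (Fin n) (Fin n) 𝕂) (p q : Fin n) :
    (w0bar n 𝕂 * M) p q = (-1) ^ (n - 1 - (p : ℕ)) * M p.rev q := by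
  rw [mul_apply, Finset.sum_eq_single p.rev]
  · rw [w0bar, if_pos (by rw [Fin.val_rev]; omega)]
  · intro r _ hr
    rw [w0bar, if_neg, zero_mul]
    contrapose! hr
    ext
    rw [Fin.val_rev]
    omega
  · simp

theorem mul_w0bar_transpose_apply (M : Matrix (Fin n) (Fin n) 𝕂) (p q : Fin n) :
    (M * (w0bar n 𝕂)ᵀ) p q = (-1) ^ (n - 1 - (q : ℕ)) * M p q.rev := by
  rw [← transpose_apply (M * _), transpose_mul, transpose_transpose, w0bar_mul_apply,
    transpose_apply]

theorem w0bar_conj_apply (M : Matrix (Fin n) (Fin n) 𝕂) (p q : Fin n) :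
    (w0bar n 𝕂 * M * (w0bar n 𝕂)ᵀ) p q =
      (-1) ^ (n - 1 - (q : ℕ)) * ((-1) ^ (n - 1 - (p : ℕ)) * M p.rev q.rev) := by
  rw [mul_w0bar_transpose_apply, w0bar_mul_apply]

theorem w0bar_transpose_mul_mul (M : Matrix (Fin n) (Fin n) 𝕂) :
    (w0bar n 𝕂)ᵀ * M * w0bar n 𝕂 = w0bar n 𝕂 * M * (w0bar n 𝕂)ᵀ := by
  nth_rw 2 [w0bar_eq_smul_transpose]
  nth_rw 3 [w0bar_eq_smul_transpose]
  rw [mul_smul_comm, smul_mul_assoc, smul_mul_assoc]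

theorem w0bar_mul_mul_mul_transpose_mul_transpose (M M' : Matrix (Fin n) (Fin n) 𝕂) :
    w0bar n 𝕂 * w0bar n 𝕂 * M * ((w0bar n 𝕂)ᵀ * (w0bar n 𝕂)ᵀ) * M' = M * M' := by
  have h : w0bar n 𝕂 * w0bar n 𝕂 = (-1 : 𝕂) ^ (n - 1) • 1 := by
    nth_rw 2 [w0bar_eq_smul_transpose]
    rw [mul_smul_comm, w0bar_mul_transpose]
  have h' : (w0bar n 𝕂)ᵀ * (w0bar n 𝕂)ᵀ = (-1 : 𝕂) ^ (n - 1) • 1 := by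
    rw [← transpose_mul, h, transpose_smul, transpose_one]
  rw [h, h']
  simp [smul_smul, ← pow_add]

theorem w0bar_conj_upper {M : Matrix (Fin n) (Fin n) 𝕂}
    (hM : ∀ a b : Fin n, a < b → M a b = 0) (p q : Fin n) (hpq : q < p) :
    (w0bar n 𝕂 * M * (w0bar n 𝕂)ᵀ) p q = 0 := by
  rw [w0bar_conj_apply, hM _ _ (Fin.rev_lt_rev.mpr hpq), mul_zero, mul_zero]

theorem w0bar_conj_diag {M : Matrix (Fin n) (Fin n) 𝕂} (hM : ∀ a : Fin n, M a a = 1)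
    (p : Fin n) : (w0bar n 𝕂 * M * (w0bar n 𝕂)ᵀ) p p = 1 := by
  rw [w0bar_conj_apply, hM, mul_one, ← pow_add, Even.neg_one_pow ⟨_, rfl⟩]

end Matrices

section Triangular

variable {n : ℕ} {𝕂 : Type*} [Field 𝕂]

theorem blockTriangular_id_iff {M : Matrix (Fin n) (Fin n) 𝕂} :
    M.BlockTriangular id ↔ ∀ a b : Fin n, b < a → M a b = 0 :=
  ⟨fun h _ _ hab => h hab, fun h _ _ hab => h _ _ hab⟩

theorem blockTriangular_toDual_iff {M : Matrix (Fin n) (Fin n) 𝕂} :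
    M.BlockTriangular OrderDual.toDual ↔ ∀ a b : Fin n, a < b → M a b = 0 :=
  ⟨fun h _ _ hab => h (OrderDual.toDual_lt_toDual.mpr hab),
    fun h _ _ hab => h _ _ (OrderDual.toDual_lt_toDual.mp hab)⟩

/-- The lower triangular matrices with unit diagonal. -/
def IsLowerUnitri (M : Matrix (Fin n) (Fin n) 𝕂) : Prop :=
  (∀ a b : Fin n, a < b → M a b = 0) ∧ ∀ a : Fin n, M a a = 1

theorem isLowerUnitri_one : IsLowerUnitri (1 : Matrix (Fin n) (Fin n) 𝕂) :=
  ⟨fun _ _ h => one_apply_ne h.ne, fun _ => one_apply_eq _⟩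

theorem lower_mul_diag {M M' : Matrix (Fin n) (Fin n) 𝕂}
    (hM : ∀ a b : Fin n, a < b → M a b = 0) (hM' : ∀ a b : Fin n, a < b → M' a b = 0)
    (a : Fin n) : (M * M') a a = M a a * M' a a := by
  rw [mul_apply, Finset.sum_eq_single a]
  · intro r _ hr
    rcases lt_or_gt_of_ne hr with h | h
    · rw [hM' _ _ h, mul_zero]
    · rw [hM _ _ h, zero_mul]
  · simp

theorem IsLowerUnitri.mul {M M' : Matrix (Fin n) (Fin n) 𝕂} (hM : IsLowerUnitri M)
    (hM' : IsLowerUnitri M') : IsLowerUnitri (M * M') :=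
  ⟨blockTriangular_toDual_iff.mp
    ((blockTriangular_toDual_iff.mpr hM.1).mul (blockTriangular_toDual_iff.mpr hM'.1)),
    fun a => by rw [lower_mul_diag hM.1 hM'.1, hM.2, hM'.2, one_mul]⟩

theorem isLowerUnitri_list_prod {l : List (Matrix (Fin n) (Fin n) 𝕂)}
    (h : ∀ M ∈ l, IsLowerUnitri M) : IsLowerUnitri l.prod := by
  induction l with
  | nil => exact isLowerUnitri_one
  | cons M l ih =>
    rw [List.prod_cons]
    exact (h M (by simp)).mul (ih fun M' hM' => h M' (by simp [hM']))

theorem isLowerUnitri_yMat (i : ℕ) (t : 𝕂) : IsLowerUnitri (yMat n 𝕂 i t) := by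
  refine ⟨fun a b hab => ?_, fun a => by simp [yMat]⟩
  rw [yMat, if_neg hab.ne, if_neg]
  have : (a : ℕ) < b := hab
  omega

theorem xNegMat_lower (i : ℕ) (t : 𝕂) (a b : Fin n) (hab : a < b) : xNegMat n 𝕂 i t a b = 0 := by
  have h : (a : ℕ) < b := hab
  rw [xNegMat, if_neg (by omega), if_neg (by omega), if_neg (by omega), if_neg hab.ne]

theorem list_prod_lower {l : List (Matrix (Fin n) (Fin n) 𝕂)}
    (h : ∀ M ∈ l, ∀ a b : Fin n, a < b → M a b = 0) (a b : Fin n) (hab : a < b) :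
    l.prod a b = 0 := by
  refine blockTriangular_toDual_iff.mp ?_ a b hab
  clear hab
  induction l with
  | nil => exact blockTriangular_one
  | cons M l ih =>
    rw [List.prod_cons]
    exact (blockTriangular_toDual_iff.mpr (h M (by simp))).mul
      (ih fun M' hM' => h M' (by simp [hM']))

/-- The inverse of an upper unitriangular matrix, transposed, is lower unitriangular. -/
theorem isLowerUnitri_transpose_of_mul_eq_one {U V : Matrix (Fin n) (Fin n) 𝕂}
    (hU : ∀ a b : Fin n, b < a → U a b = 0) (hUdiag : ∀ a : Fin n, U a a = 1) (h : U * V = 1) :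
    IsLowerUnitri Vᵀ := by
  have hV : ∀ a b : Fin n, b < a → V a b = 0 := by
    let := invertibleOfRightInverse _ _ h
    have := blockTriangular_inv_of_blockTriangular (blockTriangular_id_iff.mpr hU)
    rw [inv_eq_right_inv h] at this
    exact blockTriangular_id_iff.mp this
  refine ⟨fun a b hab => hV b a hab, fun a => ?_⟩
  have := lower_mul_diag (M := Vᵀ) (M' := Uᵀ) (fun a b hab => hV b a hab)
    (fun a b hab => hU b a hab) a
  rw [← transpose_mul, h] at this
  simpa [hUdiag] using this.symm

theorem eq_one_of_mul_isLowerUnitri {R X : Matrix (Fin n) (Fin n) 𝕂}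
    (hR : ∀ a b : Fin n, b < a → R a b = 0) (hX : IsLowerUnitri X) (hRX : IsLowerUnitri (R * X)) :
    R = 1 := by
  have key : ∀ b a : Fin n, a ≤ b → R a b = (R * X) a b := by
    intro b
    induction b using WellFoundedGT.induction with
    | ind b ih =>
      intro a hab
      rw [mul_apply, Finset.sum_eq_single b]
      · rw [hX.2, mul_one]
      · intro r _ hr
        rcases lt_or_gt_of_ne hr with h | h
        · rw [hX.1 _ _ h, mul_zero]
        · rw [ih r h a (hab.trans h.le), hRX.1 _ _ (hab.trans_lt h), zero_mul]
      · simp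
  ext a b
  rcases lt_trichotomy a b with h | rfl | h
  · rw [key _ _ h.le, hRX.1 _ _ h, one_apply_ne h.ne]
  · rw [key _ _ le_rfl, hRX.2, one_apply_eq]
  · rw [hR _ _ h, one_apply_ne h.ne']

theorem eq_mul_diagonal_of_lower_of_upper {b Y S : Matrix (Fin n) (Fin n) 𝕂}
    (hb : ∀ p q : Fin n, p < q → b p q = 0) (hY : IsLowerUnitri Y)
    (hS : ∀ p q : Fin n, q < p → S p q = 0) (h : b = Y * S) :
    b = Y * diagonal fun p => b p p := by
  have hS' : ∀ p q : Fin n, p < q → S p q = 0 := by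
    intro p
    induction p using WellFoundedLT.induction with
    | ind p ih =>
      intro q hpq
      rw [← hb p q hpq, h, mul_apply, Finset.sum_eq_single p]
      · rw [hY.2, one_mul]
      · intro r _ hr
        rcases lt_or_gt_of_ne hr with h | h
        · rw [ih r h q (h.trans hpq), mul_zero]
        · rw [hY.1 _ _ h, zero_mul]
      · simp
  have hSd : S = diagonal fun p => b p p := by
    ext p q
    rcases lt_trichotomy p q with hpq | rfl | hpq
    · rw [hS' _ _ hpq, diagonal_apply_ne _ hpq.ne]
    · rw [diagonal_apply_eq, h, lower_mul_diag hY.1 hS', hY.2, one_mul]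
    · rw [hS _ _ hpq, diagonal_apply_ne _ hpq.ne']
  rw [← hSd, h]

end Triangular

section Factorization

variable {n : ℕ} {𝕂 : Type*} [Field 𝕂]

/-- The product of the first `j` rows of the string factorisation with coordinates `w`. -/
noncomputable def xNegRows (n : ℕ) {𝕂 : Type*} [Field 𝕂] (w : ℕ → ℕ → 𝕂) (j : ℕ) :
    Matrix (Fin n) (Fin n) 𝕂 :=
  ((List.range j).map fun i => xNegRow n (w i) (n - 1 - i)).prod

/-- The product of the first `k` rows of the factorisation into matrices `y_i`, with parameters
the diagonal entries of the rows of the string factorisation with coordinates `w`. -/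
noncomputable def yRows (n : ℕ) {𝕂 : Type*} [Field 𝕂] (w : ℕ → ℕ → 𝕂) (k : ℕ) :
    Matrix (Fin n) (Fin n) 𝕂 :=
  ((List.range k).map fun i => yRow n
    (fun a => w (n - 2 - i - a) i / w (n - 2 - i - a) (i + 1)) (n - 1 - i)).prod

/-- The `k`-th column of the product of the first `j` rows of the string factorisation. -/
noncomputable def stringCol (n : ℕ) {𝕂 : Type*} [Field 𝕂] (w : ℕ → ℕ → 𝕂) (j k : ℕ) :
    Fin n → 𝕂 :=
  xNegRows n w j *ᵥ natBasis n 𝕂 k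

/-- The matrix whose columns are the first columns of the partial products of the rows of the
string factorisation. -/
noncomputable def firstColMat (n : ℕ) {𝕂 : Type*} [Field 𝕂] (w : ℕ → ℕ → 𝕂) :
    Matrix (Fin n) (Fin n) 𝕂 :=
  fun a b => stringCol n w b 0 a

theorem xNegRows_succ (w : ℕ → ℕ → 𝕂) (j : ℕ) :
    xNegRows n w (j + 1) = xNegRows n w j * xNegRow n (w j) (n - 1 - j) := by
  simp [xNegRows, List.range_succ]

theorem yRows_succ (w : ℕ → ℕ → 𝕂) (k : ℕ) :
    yRows n w (k + 1) = yRows n w k * yRow n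
      (fun a => w (n - 2 - k - a) k / w (n - 2 - k - a) (k + 1)) (n - 1 - k) := by
  simp [yRows, List.range_succ]

theorem stringCol_zero (w : ℕ → ℕ → 𝕂) (k : ℕ) : stringCol n w 0 k = natBasis n 𝕂 k := by
  simp [stringCol, xNegRows]

theorem firstColMat_mulVec (w : ℕ → ℕ → 𝕂) (k : ℕ) (hk : k < n) :
    firstColMat n w *ᵥ natBasis n 𝕂 k = stringCol n w k 0 :=
  mulVec_natBasis (firstColMat n w) ⟨k, hk⟩

variable {w : ℕ → ℕ → 𝕂}

theorem stringCol_succ (hw : ∀ j, w j 0 = 1) (j k : ℕ) (hjk : j + k + 1 < n) :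
    stringCol n w (j + 1) k =
      (w j k / w j (k + 1)) • stringCol n w j k + stringCol n w j (k + 1) := by
  rw [stringCol, xNegRows_succ, ← mulVec_mulVec,
    xNegRow_mulVec_of_lt _ (hw j) _ _ (by omega) (by omega), mulVec_add, mulVec_smul]
  rfl

theorem stringCol_of_lt (hw : ∀ j, w j 0 = 1) (i j : ℕ) (hij : i < j) (hj : j < n) :
    stringCol n w j (n - 1 - i) = w i (n - 1 - i) • stringCol n w i (n - 1 - i) := by
  induction j with
  | zero => omega
  | succ j ih =>
    rw [stringCol, xNegRows_succ, ← mulVec_mulVec]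
    rcases Nat.lt_succ_iff_lt_or_eq.mp hij with h | rfl
    · rw [xNegRow_mulVec_of_gt _ _ _ (by omega) (by omega)]
      exact ih h (by omega)
    · rw [xNegRow_mulVec_self _ (hw i) _ (by omega), mulVec_smul]
      rfl

theorem firstColMat_mul_yRows_mulVec (hw : ∀ j, w j 0 = 1) (k a : ℕ) (hka : k + a < n) :
    (firstColMat n w * w0bar n 𝕂 * yRows n w k) *ᵥ natBasis n 𝕂 a =
      (-1 : 𝕂) ^ a • stringCol n w (n - 1 - k - a) k := by
  induction k generalizing a with
  | zero =>
    simp only [yRows, List.range_zero, List.map_nil, List.prod_nil, mul_one, Nat.sub_zero]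
    rw [← mulVec_mulVec, w0bar_mulVec a (by omega), mulVec_smul,
      firstColMat_mulVec _ _ (by omega)]
  | succ k ih =>
    rw [yRows_succ, ← mul_assoc, ← mulVec_mulVec, yRow_mulVec_of_lt _ _ _ (by omega) (by omega),
      mulVec_add, mulVec_smul, ih a (by omega), ih (a + 1) (by omega)]
    obtain ⟨j, rfl⟩ : ∃ j, n = j + k + a + 2 := ⟨n - (k + a + 2), by omega⟩
    rw [(by omega : j + k + a + 2 - 1 - k - a = j + 1),
      (by omega : j + k + a + 2 - 1 - k - (a + 1) = j),
      (by omega : j + k + a + 2 - 1 - (k + 1) - a = j),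
      (by omega : j + k + a + 2 - 2 - k - a = j), stringCol_succ hw j k (by omega)]
    module

theorem firstColMat_mul_yRows_mulVec_of_le (hw : ∀ j, w j 0 = 1)
    (k a : ℕ) (ha : a < n) (hka : n ≤ k + a + 1) :
    (firstColMat n w * w0bar n 𝕂 * yRows n w k) *ᵥ natBasis n 𝕂 a =
      (-1 : 𝕂) ^ a • natBasis n 𝕂 (n - 1 - a) := by
  induction k with
  | zero =>
    obtain rfl : n = a + 1 := by omega
    rw [firstColMat_mul_yRows_mulVec hw 0 a (by omega)]
    simp [stringCol_zero]
  | succ k ih =>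
    rcases Nat.lt_or_ge (k + a + 1) n with h | h
    · rw [firstColMat_mul_yRows_mulVec hw (k + 1) a (by omega),
        (by omega : n - 1 - (k + 1) - a = 0), (by omega : n - 1 - a = k + 1), stringCol_zero]
    · rw [yRows_succ, ← mul_assoc, ← mulVec_mulVec, yRow_mulVec_of_le _ _ _ ha (by omega), ih h]

theorem firstColMat_mul_yRows (hw : ∀ j, w j 0 = 1) :
    firstColMat n w * w0bar n 𝕂 * yRows n w (n - 1) = w0bar n 𝕂 :=
  ext_natBasis fun k hk => by
    rw [firstColMat_mul_yRows_mulVec_of_le hw _ _ hk (by omega), w0bar_mulVec k hk]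

theorem w0bar_conj_yRows_mul_firstColMat (hw : ∀ j, w j 0 = 1) :
    w0bar n 𝕂 * yRows n w (n - 1) * (w0bar n 𝕂)ᵀ * firstColMat n w = 1 := by
  rw [mul_eq_one_comm, ← mul_assoc, ← mul_assoc, firstColMat_mul_yRows hw, w0bar_mul_transpose]

theorem stringCol_apply_eq_zero (hw : ∀ j, w j 0 = 1)
    (j k : ℕ) (hjk : j + k < n) (p : Fin n) (hp : (p : ℕ) < j)
    {P : Matrix (Fin n) (Fin n) 𝕂} (hP : P * firstColMat n w = 1) :
    (P *ᵥ stringCol n w j k) p = 0 := by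
  induction k generalizing j with
  | zero =>
    rw [← firstColMat_mulVec _ _ (by omega), mulVec_mulVec, hP, one_mulVec, natBasis,
      if_neg hp.ne]
  | succ k ih =>
    have h := congrArg (fun v => (P *ᵥ v) p) (stringCol_succ hw j k (by omega))
    simp only [mulVec_add, mulVec_smul, Pi.add_apply, Pi.smul_apply] at h
    rw [ih j (by omega) hp, ih (j + 1) (by omega) (by omega)] at h
    simpa using h.symm

theorem mul_stringCol_apply_self (hw : ∀ j, w j 0 = 1)
    (hw' : ∀ j k, j + k < n → w j k ≠ 0) (j : Fin n) (k : ℕ)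
    (hjk : j + k < n) {P : Matrix (Fin n) (Fin n) 𝕂} (hP : P * firstColMat n w = 1) :
    w j k * (P *ᵥ stringCol n w j k) j = (-1) ^ k := by
  induction k with
  | zero =>
    rw [← firstColMat_mulVec _ _ (by omega), mulVec_mulVec, hP, one_mulVec, natBasis,
      if_pos rfl, hw, mul_one, pow_zero]
  | succ k ih =>
    have h := congrArg (fun v => (P *ᵥ v) j) (stringCol_succ hw j k (by omega))
    simp only [mulVec_add, mulVec_smul, Pi.add_apply, Pi.smul_apply, smul_eq_mul] at h
    rw [stringCol_apply_eq_zero hw (j + 1) k (by omega) j (by omega) hP] at h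
    have h1 := hw' j (k + 1) (by omega)
    rw [eq_neg_of_add_eq_zero_right h.symm, pow_succ, ← ih (by omega)]
    field_simp

theorem isLowerUnitri_mul_xNegRows (hw : ∀ j, w j 0 = 1) (hw' : ∀ j k, j + k < n → w j k ≠ 0)
    {P : Matrix (Fin n) (Fin n) 𝕂} (hP : P * firstColMat n w = 1) :
    IsLowerUnitri (P * xNegRows n w (n - 1) * (w0bar n 𝕂)ᵀ) := by
  have key : ∀ p q : Fin n, (P * xNegRows n w (n - 1) * (w0bar n 𝕂)ᵀ) p q =
      (-1) ^ (n - 1 - (q : ℕ)) *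
        (w q (n - 1 - q) * (P *ᵥ stringCol n w q (n - 1 - q)) p) := by
    intro p q
    have h : stringCol n w (n - 1) (n - 1 - q) =
        w q (n - 1 - q) • stringCol n w q (n - 1 - q) := by
      rcases Nat.lt_or_ge q (n - 1) with h | h
      · exact stringCol_of_lt hw q (n - 1) h (by omega)
      · obtain h' : (q : ℕ) = n - 1 := by omega
        rw [h', Nat.sub_self, hw, one_smul]
    have h2 := congrFun (mulVec_natBasis (P * xNegRows n w (n - 1) * (w0bar n 𝕂)ᵀ) q) p
    rw [← h2, ← mulVec_mulVec, w0bar_transpose_mulVec _ q.2, ← mulVec_mulVec, mulVec_smul]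
    change (P *ᵥ (_ • stringCol n w (n - 1) (n - 1 - q))) p = _
    rw [h]
    simp [mulVec_smul]
  refine ⟨fun a b hab => ?_, fun a => ?_⟩
  · rw [key, stringCol_apply_eq_zero hw _ _ (by omega) a hab hP, mul_zero, mul_zero]
  · rw [key, mul_stringCol_apply_self hw hw' _ _ (by omega) hP, ← pow_add,
      Even.neg_one_pow ⟨_, rfl⟩]

end Factorization

theorem list_prod_yMat_eq_yRows {n : ℕ} (hn : 2 ≤ n) {𝕂 : Type*} [Field 𝕂] {z m : ℕ → 𝕂}
    (hm : ∀ k a, 1 ≤ k → k ≤ n - 1 → 1 ≤ a → a ≤ n - k →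
      m (sIdx n k + a) =
        if k = 1 then z (1 + sIdx n (n - a))
        else z (k + sIdx n (n - k - a + 1)) / z (k - 1 + sIdx n (n - k - a + 1))) :
    ((List.range (sIdx n n)).map
      (fun t => yMat n 𝕂 ((wordI0 n).getD t 0) (m (t + 1))⁻¹)).prod =
      yRows n (fun j k => if k = 0 then 1 else z (sIdx n (j + 1) + k)) (n - 1) := by
  obtain ⟨r, rfl⟩ : ∃ r, n = r + 2 := ⟨n - 2, by omega⟩
  rw [show sIdx (r + 2) (r + 2) = sIdx (r + 2) (r + 1 + 1) from rfl,
    prod_wordI0 (r + 2) (fun i t => yMat (r + 2) 𝕂 i (m t)⁻¹) (r + 1) (by omega), yRows]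
  congr 1
  refine List.map_congr_left fun i hi => ?_
  rw [yRow]
  congr 1
  refine List.map_congr_left fun a ha => ?_
  rw [List.mem_range] at hi ha
  obtain ⟨j, rfl⟩ : ∃ j, r = j + i + a := ⟨r - i - a, by omega⟩
  rw [hm (i + 1) (a + 1) (by omega) (by omega) (by omega) (by omega),
    (by omega : j + i + a + 2 - 2 - i - a = j),
    (by omega : j + i + a + 2 - (i + 1) - (a + 1) + 1 = j + 1)]
  congr 1
  rcases Nat.eq_zero_or_pos i with rfl | hi0
  · rw [(by omega : j + 0 + a + 2 - (a + 1) = j + 1)]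
    simp [add_comm]
  · simp [hi0.ne', add_comm, inv_div]

theorem list_prod_xNegMat_eq_xNegRows {n : ℕ} (hn : 2 ≤ n) {𝕂 : Type*} [Field 𝕂] (z : ℕ → 𝕂) :
    ((List.range (sIdx n n)).map
      (fun t => xNegMat n 𝕂 ((wordI0 n).getD t 0) (z (t + 1)))).prod =
      xNegRows n (fun j k => if k = 0 then 1 else z (sIdx n (j + 1) + k)) (n - 1) := by
  obtain ⟨r, rfl⟩ : ∃ r, n = r + 2 := ⟨n - 2, by omega⟩
  rw [show sIdx (r + 2) (r + 2) = sIdx (r + 2) (r + 1 + 1) from rfl,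
    prod_wordI0 (r + 2) (fun i t => xNegMat (r + 2) 𝕂 i (z t)) (r + 1) (by omega)]
  simp [xNegRows, xNegRow]

/-- A matrix with a decomposition `(w̄₀ uᵀ)⁻¹ = L D U` satisfies `U⁻ᵀ = D Lᵀ u w̄₀ᵀ`, so any lower
unitriangular `K⁻¹ u w̄₀ᵀ` with `K` upper triangular equals `U⁻ᵀ`. -/
theorem transpose_inv_eq_of_LDU {n : ℕ} {𝕂 : Type*} [Field 𝕂]
    {u L D U K X : Matrix (Fin n) (Fin n) 𝕂}
    (hL : ∀ a b : Fin n, a < b → L a b = 0)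
    (hD : ∀ a b : Fin n, a ≠ b → D a b = 0)
    (hU : ∀ a b : Fin n, b < a → U a b = 0) (hUdiag : ∀ a : Fin n, U a a = 1)
    (hu : IsUnit (w0bar n 𝕂 * uᵀ).det)
    (hLDU : (w0bar n 𝕂 * uᵀ)⁻¹ = L * D * U)
    (hK : ∀ a b : Fin n, b < a → K a b = 0)
    (hX : IsLowerUnitri X) (hKX : K * X = u * (w0bar n 𝕂)ᵀ) : (U⁻¹)ᵀ = X := by
  have h1 : U * (w0bar n 𝕂 * uᵀ * (L * D)) = 1 := by
    rw [← mul_assoc, mul_eq_one_comm, ← mul_assoc, ← hLDU, nonsing_inv_mul _ hu]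
  have hG := isLowerUnitri_transpose_of_mul_eq_one hU hUdiag h1
  have h2 : (w0bar n 𝕂 * uᵀ * (L * D))ᵀ = Dᵀ * Lᵀ * K * X := by
    rw [mul_assoc _ K, hKX]
    simp only [transpose_mul, transpose_transpose, mul_assoc]
  have hR : (Dᵀ * Lᵀ * K).BlockTriangular id :=
    ((blockTriangular_id_iff.mpr fun a b h => hD b a h.ne).mul
      (blockTriangular_id_iff.mpr fun a b h => hL b a h)).mul (blockTriangular_id_iff.mpr hK)
  rw [h2] at hG
  rw [inv_eq_right_inv h1, h2,
    eq_one_of_mul_isLowerUnitri (blockTriangular_id_iff.mp hR) hX hG, one_mul]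

/-- with the ideal coordinates m defined from the string coordinates z,
b factorises as b = y_{i_1}(m_1⁻¹)⋯y_{i_N}(m_N⁻¹)·t_R where (i_1,…,i_N) = 𝐢₀ and
t_R is the diagonal part of b. -/
theorem stmt5
    (𝕂 : Type*) [Field 𝕂]
    (n N : ℕ) (hn : 2 ≤ n) (hN : N = n * (n - 1) / 2)
    (z : ℕ → 𝕂) (hz : ∀ j, 1 ≤ j → j ≤ N → z j ≠ 0)
    (u : Matrix (Fin n) (Fin n) 𝕂)
    (hu : u = ((List.range N).map
      (fun t => xNegMat n 𝕂 ((wordI0 n).getD t 0) (z (t + 1)))).prod)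
    (L D U : Matrix (Fin n) (Fin n) 𝕂)
    (hL : ∀ a b : Fin n, a < b → L a b = 0) (hLdiag : ∀ a : Fin n, L a a = 1)
    (hD : ∀ a b : Fin n, a ≠ b → D a b = 0) (hDinv : ∀ a : Fin n, D a a ≠ 0)
    (hU : ∀ a b : Fin n, b < a → U a b = 0) (hUdiag : ∀ a : Fin n, U a a = 1)
    (hLDU : (w0bar n 𝕂 * u.transpose)⁻¹ = L * D * U)
    (u₁ : Matrix (Fin n) (Fin n) 𝕂)
    (hu₁ : u₁ = (w0bar n 𝕂 * U⁻¹ * (w0bar n 𝕂)⁻¹).transpose)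
    (d : Matrix (Fin n) (Fin n) 𝕂)
    (hd : ∀ a b : Fin n, a ≠ b → d a b = 0) (hdinv : ∀ a : Fin n, d a a ≠ 0)
    (u₂ : Matrix (Fin n) (Fin n) 𝕂)
    (hu₂ : ∀ a b : Fin n, b < a → u₂ a b = 0) (hu₂diag : ∀ a : Fin n, u₂ a a = 1)
    (b : Matrix (Fin n) (Fin n) 𝕂)
    (hb : b = u₁ * d * w0bar n 𝕂 * u₂)
    (hblower : ∀ p q : Fin n, p < q → b p q = 0)
    (m : ℕ → 𝕂)
    (hm : ∀ k a, 1 ≤ k → k ≤ n - 1 → 1 ≤ a → a ≤ n - k →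
      m (sIdx n k + a) =
        if k = 1 then z (1 + sIdx n (n - a))
        else z (k + sIdx n (n - k - a + 1)) / z (k - 1 + sIdx n (n - k - a + 1))) :
    b = ((List.range N).map
          (fun t => yMat n 𝕂 ((wordI0 n).getD t 0) (m (t + 1))⁻¹)).prod *
        Matrix.diagonal (fun p => b p p) := by
  obtain rfl : N = sIdx n n := hN.trans (sIdx_self n (by omega)).symm
  set w : ℕ → ℕ → 𝕂 := fun j k => if k = 0 then 1 else z (sIdx n (j + 1) + k) with hw_def
  have hw : ∀ j, w j 0 = 1 := fun j => by simp [hw_def]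
  have hw' : ∀ j k, j + k < n → w j k ≠ 0 := by
    intro j k hjk
    rcases Nat.eq_zero_or_pos k with rfl | hk
    · simp [hw]
    · have := sIdx_add_le n j k hn hk (by omega)
      simpa [hw_def, hk.ne'] using hz _ (by omega) (by omega)
  rw [list_prod_yMat_eq_yRows hn hm]
  have hY : IsLowerUnitri (yRows n w (n - 1)) :=
    isLowerUnitri_list_prod fun M hM => by
      obtain ⟨i, -, rfl⟩ := List.mem_map.mp hM
      refine isLowerUnitri_list_prod fun M hM => ?_
      obtain ⟨a, -, rfl⟩ := List.mem_map.mp hM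
      exact isLowerUnitri_yMat _ _
  rw [list_prod_xNegMat_eq_xNegRows hn] at hu
  have hu_lower : ∀ p q : Fin n, p < q → u p q = 0 := by
    rw [hu]
    refine list_prod_lower fun M hM => ?_
    obtain ⟨i, -, rfl⟩ := List.mem_map.mp hM
    refine list_prod_lower fun M hM => ?_
    obtain ⟨a, -, rfl⟩ := List.mem_map.mp hM
    exact xNegMat_lower _ _
  set Y := yRows n w (n - 1) with hY_def
  have hP : w0bar n 𝕂 * Y * (w0bar n 𝕂)ᵀ * firstColMat n w = 1 :=
    w0bar_conj_yRows_mul_firstColMat hw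
  have hX := isLowerUnitri_mul_xNegRows hw hw' hP
  rw [← hu] at hX
  have hK : ∀ p q : Fin n, q < p → firstColMat n w p q = 0 := fun p q hpq =>
    (isLowerUnitri_transpose_of_mul_eq_one (w0bar_conj_upper hY.1) (w0bar_conj_diag hY.2) hP).1
      q p hpq
  have hdet : IsUnit (w0bar n 𝕂 * uᵀ).det := by
    have h := det_of_isLowerTriangular _ (blockTriangular_toDual_iff.mpr hX.1)
    simp only [hX.2, Finset.prod_const_one] at h
    rw [mul_assoc _ u, det_mul, det_mul u, det_transpose] at h
    rw [det_mul, det_transpose, mul_comm]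
    exact IsUnit.of_mul_eq_one_right _ h
  have hG := transpose_inv_eq_of_LDU hL hD hU hUdiag hdet hLDU hK hX (by
    rw [mul_assoc _ u, ← mul_assoc, mul_eq_one_comm.mp hP, one_mul])
  refine eq_mul_diagonal_of_lower_of_upper (S := w0bar n 𝕂 * (u * d) * (w0bar n 𝕂)ᵀ * u₂)
    hblower hY ?_ ?_
  · refine blockTriangular_id_iff.mp (.mul (blockTriangular_id_iff.mpr
      (w0bar_conj_upper (blockTriangular_toDual_iff.mp (.mul ?_ ?_))))
      (blockTriangular_id_iff.mpr hu₂))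
    · exact blockTriangular_toDual_iff.mpr hu_lower
    · exact blockTriangular_toDual_iff.mpr fun p q hpq => hd p q hpq.ne
  · rw [← w0bar_transpose_mul_mul, hb, hu₁, inv_eq_right_inv w0bar_mul_transpose, transpose_mul,
      transpose_mul, hG, transpose_transpose]
    have h := w0bar_mul_mul_mul_transpose_mul_transpose (Y * (w0bar n 𝕂)ᵀ * u)
      (d * w0bar n 𝕂 * u₂)
    simp only [mul_assoc] at h ⊢
    exact h
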